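/- Let n ≥ 1 and b ≥ 1 be natural numbers, H ∈ ℕ, and let 0 = H_0 ≤ H_1 ≤ H_2 ≤ ⋯ ≤ H_n be natural numbers (deadlines). Suppose that for every i ∈ {1, …, n}: ∑_{j=1}^i min(j, b)·(H_{i+1−j} − H_{i−j}) ≥ i·H. Then there exists a selection scheme S : ℕ → Finset (Fin n) such that |S(t)| ≤ b for every time slice t ≥ 1, and for each agent i ∈ {1, …, n} the number of time slices t with 1 ≤ t ≤ H_i and i ∈ S(t) is at least H. -/

import Mathlib

/-- The `h` elements of `W` with least `f`-value. -/
theorem aux_least (W : Finset ℕ) (f : ℕ → ℕ) (h : ℕ) (hh : h ≤ W.card) :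
    ∃ P ⊆ W, P.card = h ∧ ∀ s ∈ P, ∀ t ∈ W, t ∉ P → f s ≤ f t := by
  induction h with
  | zero => exact ⟨∅, by simp, by simp, by simp⟩
  | succ h ih =>
    obtain ⟨P, hPW, hc, hP⟩ := ih (by omega)
    have hne : (W \ P).Nonempty := by
      rw [← Finset.card_pos, Finset.card_sdiff_of_subset hPW]; omega
    obtain ⟨x, hx, hmin⟩ := Finset.exists_min_image (W \ P) f hne
    rw [Finset.mem_sdiff] at hx
    refine ⟨insert x P, ?_, ?_, ?_⟩
    · intro y hy
      rcases Finset.mem_insert.1 hy with rfl | hy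
      · exact hx.1
      · exact hPW hy
    · rw [Finset.card_insert_of_notMem hx.2, hc]
    · intro s hs t ht htn
      rw [Finset.mem_insert, not_or] at htn
      rcases Finset.mem_insert.1 hs with rfl | hs
      · exact hmin t (Finset.mem_sdiff.2 ⟨ht, htn.2⟩)
      · exact hP s hs t ht htn.2

theorem aux_layer (Hd : ℕ → ℕ) (c : ℕ → ℕ) (g : ℕ → ℕ) (m : ℕ) (h0 : Hd 0 = 0)
    (hmono : ∀ k, k < m → Hd k ≤ Hd (k + 1))
    (hg : ∀ k, k < m → ∀ t, Hd k < t → t ≤ Hd (k + 1) → c k ≤ g t) :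
    ∑ k ∈ Finset.range m, c k * (Hd (k + 1) - Hd k) ≤ ∑ t ∈ Finset.Icc 1 (Hd m), g t := by
  induction m with
  | zero => simp
  | succ m ih =>
    have ih' := ih (fun k hk => hmono k (by omega)) (fun k hk => hg k (by omega))
    have hm := hmono m (by omega)
    have hU : Finset.Icc 1 (Hd (m + 1)) = Finset.Icc 1 (Hd m) ∪ Finset.Ioc (Hd m) (Hd (m + 1)) := by
      ext t; simp only [Finset.mem_Icc, Finset.mem_union, Finset.mem_Ioc]; omega
    have hD : Disjoint (Finset.Icc 1 (Hd m)) (Finset.Ioc (Hd m) (Hd (m + 1))) := by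
      rw [Finset.disjoint_left]; intro t; simp only [Finset.mem_Icc, Finset.mem_Ioc]; omega
    rw [Finset.sum_range_succ, hU, Finset.sum_union hD]
    refine Nat.add_le_add ih' ?_
    have := Finset.card_nsmul_le_sum (Finset.Ioc (Hd m) (Hd (m + 1))) g (c m) (by
      intro t ht
      rw [Finset.mem_Ioc] at ht
      exact hg m (by omega) t ht.1 ht.2)
    rw [Nat.card_Ioc, smul_eq_mul] at this
    rw [Nat.mul_comm]; exact this

theorem aux_cap (Hd : ℕ → ℕ) (b i : ℕ) (h0 : Hd 0 = 0)
    (hmono : ∀ k, k < i → Hd k ≤ Hd (k + 1)) (N : ℕ)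
    (hcap : (∑ j ∈ Finset.Icc 1 i, (min j b : ℤ) * ((Hd (i + 1 - j) : ℤ) - (Hd (i - j) : ℤ)))
        ≥ (N : ℤ)) :
    N ≤ ∑ t ∈ Finset.Icc 1 (Hd i),
      min b (((Finset.range i).filter fun k => t ≤ Hd (k + 1)).card) := by
  have hm : ∀ a c, a ≤ c → c ≤ i → Hd a ≤ Hd c := by
    intro a c hac hci
    induction c, hac using Nat.le_induction with
    | base => exact le_rfl
    | succ c hc ih => exact (ih (by omega)).trans (hmono c (by omega))
  refine le_trans ?_ (aux_layer Hd (fun k => min (i - k) b) _ i h0 hmono ?_)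
  · have : (∑ j ∈ Finset.Icc 1 i, (min j b : ℤ) * ((Hd (i + 1 - j) : ℤ) - (Hd (i - j) : ℤ)))
      = ((∑ k ∈ Finset.range i, min (i - k) b * (Hd (k + 1) - Hd k) : ℕ) : ℤ) := by
      rw [Nat.cast_sum]
      refine Finset.sum_bij' (fun j _ => i - j) (fun k _ => i - k) ?_ ?_ ?_ ?_ ?_
      · intro j hj; simp only [Finset.mem_Icc, Finset.mem_range] at *; omega
      · intro j hj; simp only [Finset.mem_Icc, Finset.mem_range] at *; omega
      · intro j hj; simp only [Finset.mem_Icc, Finset.mem_range] at *; omega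
      · intro j hj; simp only [Finset.mem_Icc, Finset.mem_range] at *; omega
      · intro j hj
        simp only [Finset.mem_Icc] at hj
        have e1 : i - (i - j) = j := by omega
        have e2 : i + 1 - j = i - j + 1 := by omega
        rw [e1, e2, Nat.cast_mul, Nat.cast_sub (hmono (i - j) (by omega)), Nat.cast_min]
    rw [this] at hcap
    exact_mod_cast hcap
  · intro k hk t h1 h2
    have : Finset.Ico k i ⊆ (Finset.range i).filter fun k => t ≤ Hd (k + 1) := by
      intro x hx
      rw [Finset.mem_Ico] at hx
      rw [Finset.mem_filter, Finset.mem_range]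
      exact ⟨hx.2, h2.trans (hm _ _ (by omega) (by omega))⟩
    have := Finset.card_le_card this
    rw [Nat.card_Ico] at this
    omega

theorem aux_main (n b : ℕ) (H : ℕ) (Hd : ℕ → ℕ)
    (hmono : ∀ a c, a ≤ c → c ≤ n → Hd a ≤ Hd c)
    (hcap : ∀ i, 1 ≤ i → i ≤ n → i * H ≤ ∑ t ∈ Finset.Icc 1 (Hd i),
      min b (((Finset.range i).filter fun k => t ≤ Hd (k + 1)).card)) (m : ℕ) (hmn : m ≤ n) :
    ∃ P : ℕ → Finset ℕ,
      (∀ k, k < m → P k ⊆ Finset.Icc 1 (Hd (k + 1)) ∧ (P k).card = H) ∧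
      (∀ t, ((Finset.range m).filter fun k => t ∈ P k).card ≤ b) ∧
      (∀ k, k < m → ∀ s ∈ P k, ∀ t ∈ Finset.Icc 1 (Hd (k + 1)), t ∉ P k →
        ((Finset.range m).filter fun k => s ∈ P k).card ≤
          ((Finset.range m).filter fun k => t ∈ P k).card + 1) := by
  induction m with
  | zero => exact ⟨fun _ => ∅, by simp, by simp, by simp⟩
  | succ m ih =>
    obtain ⟨P, hP, hb, hbal⟩ := ih (by omega)
    set L : ℕ → ℕ := fun t => ((Finset.range m).filter fun k => t ∈ P k).card with hL
    set W := Finset.Icc 1 (Hd (m + 1)) with hW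
    have hsub : ∀ k, k < m → P k ⊆ W := by
      intro k hk
      refine (hP k hk).1.trans (Finset.Icc_subset_Icc_right (hmono _ _ (by omega) (by omega)))
    have hsum : ∑ t ∈ W, L t = m * H := by
      have h1 : ∑ t ∈ W, L t = ∑ k ∈ Finset.range m, (W.filter fun t => t ∈ P k).card := by
        simp only [hL, Finset.card_filter]
        exact Finset.sum_comm
      rw [h1, Finset.sum_congr rfl (g := fun _ => H)]
      · simp
      · intro k hk
        have hk := Finset.mem_range.1 hk
        rw [Finset.filter_mem_eq_inter, Finset.inter_eq_right.2 (hsub k hk), (hP k hk).2]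
    have hU : H ≤ (W.filter fun t => L t < b).card := by
      by_contra hlt
      push Not at hlt
      have hc := hcap (m + 1) (by omega) hmn
      have hpt : ∀ t ∈ W, min b (((Finset.range (m + 1)).filter fun k => t ≤ Hd (k + 1)).card)
          ≤ L t + if L t < b then 1 else 0 := by
        intro t ht
        have hbt : L t ≤ b := hb t
        by_cases h1 : L t + 1 < b
        · rw [if_pos (by omega)]
          refine (min_le_right _ _).trans ?_
          rw [Finset.range_add_one, Finset.filter_insert]
          have : (Finset.range m).filter (fun k => t ≤ Hd (k + 1)) ⊆
              (Finset.range m).filter fun k => t ∈ P k := by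
            intro k hk
            rw [Finset.mem_filter, Finset.mem_range] at hk ⊢
            refine ⟨hk.1, ?_⟩
            by_contra hn
            have hsubU : P k ⊆ W.filter fun t => L t < b := by
              intro s hs
              rw [Finset.mem_filter]
              refine ⟨hsub k hk.1 hs, ?_⟩
              have : L s ≤ L t + 1 := hbal k hk.1 s hs t
                (Finset.mem_Icc.2 ⟨(Finset.mem_Icc.1 ht).1, hk.2⟩) hn
              omega
            have := Finset.card_le_card hsubU
            rw [(hP k hk.1).2] at this
            omega
          have := Finset.card_le_card this
          split_ifs
          · exact (Finset.card_insert_le _ _).trans (Nat.add_le_add_right this 1)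
          · exact this.trans (Nat.le_succ _)
        · refine (min_le_left _ _).trans ?_
          split_ifs <;> omega
      have h2 := hc.trans (Finset.sum_le_sum hpt)
      rw [← hW, Finset.sum_add_distrib, hsum, ← Finset.card_filter, Nat.add_mul] at h2
      omega
    obtain ⟨Q, hQW, hQc, hQ⟩ := aux_least W L H (hU.trans (Finset.card_filter_le _ _))
    have hQb : ∀ s ∈ Q, L s < b := by
      intro s hs
      by_contra hsb
      have : (W.filter fun t => L t < b) ⊂ Q := by
        rw [Finset.ssubset_iff_of_subset]
        · exact ⟨s, hs, by simp [hsb]⟩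
        · intro t ht
          rw [Finset.mem_filter] at ht
          by_contra htQ
          have := hQ s hs t ht.1 htQ
          omega
      have := Finset.card_lt_card this
      omega
    have hnew : ∀ t, ((Finset.range (m + 1)).filter fun k => t ∈ Function.update P m Q k).card
        = L t + if t ∈ Q then 1 else 0 := by
      intro t
      simp only [hL, Finset.card_filter]
      rw [Finset.sum_range_succ, Function.update_self]
      congr 1
      refine Finset.sum_congr rfl fun k hk => ?_
      rw [Function.update_of_ne (Finset.mem_range.1 hk).ne]
    refine ⟨Function.update P m Q, ?_, ?_, ?_⟩
    · intro k hk
      by_cases h : k = m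
      · subst h; rw [Function.update_self]; exact ⟨hQW, hQc⟩
      · rw [Function.update_of_ne h]; exact hP k (by omega)
    · intro t
      rw [hnew]
      have : L t ≤ b := hb t
      split_ifs with h
      · exact hQb t h
      · exact this
    · intro k hk s hs t ht htn
      rw [hnew, hnew]
      by_cases h : k = m
      · subst h
        rw [Function.update_self] at hs htn
        have := hQ s hs t ht htn
        rw [if_pos hs, if_neg htn]; omega
      · rw [Function.update_of_ne h] at hs htn
        have hk' : k < m := by omega
        have h1 : L s ≤ L t + 1 := hbal k hk' s hs t ht htn
        have htW : t ∈ W :=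
          Finset.Icc_subset_Icc_right (hmono _ _ (by omega) (by omega)) ht
        by_cases hsQ : s ∈ Q <;> by_cases htQ : t ∈ Q
        · simp only [hsQ, htQ, if_true]; omega
        · have := hQ s hsQ t htW htQ
          simp only [hsQ, htQ, if_true, if_false]; omega
        · simp only [hsQ, htQ, if_true, if_false]; omega
        · simp only [hsQ, htQ, if_false]; omega


/-- Combinatorial scheduling claim (eqs. (40)-(43)) in the proof of
Theorem 4: with deadlines `0 = H_0 ≤ H_1 ≤ ⋯ ≤ H_n` and capacity conditions
`∑_{j=1}^i min(j,b)·(H_{i+1−j} − H_{i−j}) ≥ i·H` for every `i`, there is a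
selection scheme serving at most `b` agents per time slice such that each
agent `i` is served at least `H` times within its first `H_i` time slices. -/
theorem stmt12 (n b : ℕ) (hn : 1 ≤ n) (hb : 1 ≤ b) (H : ℕ) (Hd : ℕ → ℕ)
    (hHd0 : Hd 0 = 0) (hmono : ∀ k, k < n → Hd k ≤ Hd (k + 1))
    (hcap : ∀ i, 1 ≤ i → i ≤ n →
      (∑ j ∈ Finset.Icc 1 i, (min j b : ℤ) * ((Hd (i + 1 - j) : ℤ) - (Hd (i - j) : ℤ)))
        ≥ (i : ℤ) * H) :
    ∃ S : ℕ → Finset (Fin n),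
      (∀ t, 1 ≤ t → (S t).card ≤ b) ∧
      ∀ i : Fin n,
        H ≤ ((Finset.Icc 1 (Hd (i.val + 1))).filter fun t => i ∈ S t).card := by

  have hm : ∀ a c, a ≤ c → c ≤ n → Hd a ≤ Hd c := by
    intro a c hac hci
    induction c, hac using Nat.le_induction with
    | base => exact le_rfl
    | succ c hc ih => exact (ih (by omega)).trans (hmono c (by omega))
  obtain ⟨P, hP, hPb, -⟩ := aux_main n b H Hd hm (fun i h1 h2 =>
    aux_cap Hd b i hHd0 (fun k hk => hmono k (by omega)) (i * H)
      (by have := hcap i h1 h2; push_cast; exact this)) n le_rfl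
  refine ⟨fun t => Finset.univ.filter fun i : Fin n => t ∈ P i.val, ?_, ?_⟩
  · intro t _
    refine le_trans ?_ (hPb t)
    refine Finset.card_le_card_of_injOn (fun i => i.val) ?_ ?_
    · intro i hi
      simpa using hi
    · intro i _ j _ h
      exact Fin.ext h
  · intro i
    obtain ⟨h1, h2⟩ := hP i.val i.isLt
    rw [← h2]
    refine Finset.card_le_card ?_
    intro t ht
    simp only [Finset.mem_filter, Finset.mem_univ, true_and]
    exact ⟨h1 ht, ht⟩
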